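/- arXiv:2208.01519 — 2 statements merged into one kernel-verified Lean document; each statement's English description precedes it below -/
import Mathlib

section
/- There exists a 3-regular simple graph on 8 vertices with a proper 3-edge-coloring (namely the Möbius ladder M₄ with outer Hamiltonian cycle edges alternating between two colors and the four antipodal chords in the third color) that contains no 4-cycle using all three edge colors, no 6-cycle with opposite edges equal in color and all three colors appearing (pattern 1,2,3,1,2,3), and no triangle with three distinctly colored edges. That is, the conclusion of the cubic-graph construction lemma also holds for k = 4. -/
/-- `G` is a cubic (3-regular) graph: every vertex has exactly three neighbors. -/
def CubicGraph {V : Type*} (G : SimpleGraph V) : Prop :=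
  ∀ v : V, (G.neighborSet v).ncard = 3

/-- `c` is a proper 3-edge-coloring of `G`: distinct edges sharing a vertex get
different colors. -/
def ProperEdgeColoring {V : Type*} (G : SimpleGraph V) (c : Sym2 V → Fin 3) : Prop :=
  ∀ e₁ ∈ G.edgeSet, ∀ e₂ ∈ G.edgeSet, e₁ ≠ e₂ → (∃ v, v ∈ e₁ ∧ v ∈ e₂) → c e₁ ≠ c e₂

/-- A 4-cycle whose four edges use all three colors. -/
def HasRainbowC4 {V : Type*} (G : SimpleGraph V) (c : Sym2 V → Fin 3) : Prop :=
  ∃ v₁ v₂ v₃ v₄ : V, List.Pairwise (· ≠ ·) [v₁, v₂, v₃, v₄] ∧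
    G.Adj v₁ v₂ ∧ G.Adj v₂ v₃ ∧ G.Adj v₃ v₄ ∧ G.Adj v₄ v₁ ∧
    (∀ col : Fin 3,
      col = c s(v₁, v₂) ∨ col = c s(v₂, v₃) ∨ col = c s(v₃, v₄) ∨ col = c s(v₄, v₁))

/-- A 6-cycle in which opposite edges have the same color and the three colors
around the cycle are pairwise distinct (pattern 1,2,3,1,2,3). -/
def HasBadC6 {V : Type*} (G : SimpleGraph V) (c : Sym2 V → Fin 3) : Prop :=
  ∃ v₁ v₂ v₃ v₄ v₅ v₆ : V, List.Pairwise (· ≠ ·) [v₁, v₂, v₃, v₄, v₅, v₆] ∧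
    G.Adj v₁ v₂ ∧ G.Adj v₂ v₃ ∧ G.Adj v₃ v₄ ∧ G.Adj v₄ v₅ ∧ G.Adj v₅ v₆ ∧ G.Adj v₆ v₁ ∧
    c s(v₁, v₂) = c s(v₄, v₅) ∧ c s(v₂, v₃) = c s(v₅, v₆) ∧ c s(v₃, v₄) = c s(v₆, v₁) ∧
    c s(v₁, v₂) ≠ c s(v₂, v₃) ∧ c s(v₂, v₃) ≠ c s(v₃, v₄) ∧ c s(v₁, v₂) ≠ c s(v₃, v₄)

/-- A triangle whose three edges have three distinct colors. -/
def HasRainbowC3 {V : Type*} (G : SimpleGraph V) (c : Sym2 V → Fin 3) : Prop :=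
  ∃ v₁ v₂ v₃ : V, List.Pairwise (· ≠ ·) [v₁, v₂, v₃] ∧
    G.Adj v₁ v₂ ∧ G.Adj v₂ v₃ ∧ G.Adj v₃ v₁ ∧
    c s(v₁, v₂) ≠ c s(v₂, v₃) ∧ c s(v₂, v₃) ≠ c s(v₃, v₁) ∧ c s(v₁, v₂) ≠ c s(v₃, v₁)

/-- The Möbius ladder on 8 vertices: the cycle `0, 1, …, 7` together with the antipodal chords. -/
def moebiusLadder : SimpleGraph (Fin 8) where
  Adj u v := v = u + 1 ∨ u = v + 1 ∨ v = u + 4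
  symm := ⟨by decide⟩
  loopless := ⟨by decide⟩

instance : DecidableRel moebiusLadder.Adj := fun u v =>
  inferInstanceAs (Decidable (v = u + 1 ∨ u = v + 1 ∨ v = u + 4))

/-- Chords get color `2`; the cycle edges alternate between `0` and `1`. -/
def ladderColoring : Sym2 (Fin 8) → Fin 3 :=
  Sym2.lift ⟨fun u v =>
    if v = u + 4 then 2
    else if v.val / 2 = u.val / 2 then 0
    else 1, by decide⟩

/-- The neighbor of `v` along the edge of color `k`. -/
def ladderStep (k : Fin 3) (v : Fin 8) : Fin 8 :=
  if k = 2 then v + 4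
  else if (v.val + k.val) % 2 = 0 then v + 1
  else v - 1

theorem ladderStep_ladderColoring {u v : Fin 8} (h : moebiusLadder.Adj u v) :
    ladderStep (ladderColoring s(u, v)) u = v := by
  revert u v
  decide

theorem moebiusLadder_cubicGraph : CubicGraph moebiusLadder := by
  intro v
  rw [Set.ncard_eq_toFinset_card']
  revert v
  decide

theorem ladderColoring_proper : ProperEdgeColoring moebiusLadder ladderColoring := by
  rintro e₁ h₁ e₂ h₂ hne ⟨v, hv₁, hv₂⟩ hc
  obtain ⟨u, rfl⟩ := hv₁
  obtain ⟨w, rfl⟩ := hv₂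
  have hu : ladderStep (ladderColoring s(v, u)) v = u := ladderStep_ladderColoring h₁
  have hw : ladderStep (ladderColoring s(v, w)) v = w := ladderStep_ladderColoring h₂
  exact hne (congrArg (fun x => s(v, x)) (hu.symm.trans (hc ▸ hw)))

theorem ladderStep_word_four (v : Fin 8) (a b c d : Fin 3)
    (h : ∀ k : Fin 3, k = a ∨ k = b ∨ k = c ∨ k = d) :
    ladderStep d (ladderStep c (ladderStep b (ladderStep a v))) ≠ v := by
  revert v a b c d
  decide +kernel

theorem ladderStep_word_six (v : Fin 8) (a b c : Fin 3) (hab : a ≠ b) (hbc : b ≠ c)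
    (hac : a ≠ c) :
    ladderStep c (ladderStep b (ladderStep a
      (ladderStep c (ladderStep b (ladderStep a v))))) ≠ v := by
  revert v a b c
  decide +kernel

theorem ladderStep_word_three (v : Fin 8) (a b c : Fin 3) (hab : a ≠ b) (hbc : b ≠ c)
    (hac : a ≠ c) :
    ladderStep c (ladderStep b (ladderStep a v)) ≠ v := by
  intro h
  exact ladderStep_word_six v a b c hab hbc hac (by rw [h, h])

theorem not_hasRainbowC4_moebiusLadder : ¬ HasRainbowC4 moebiusLadder ladderColoring := by
  rintro ⟨v₁, v₂, v₃, v₄, -, h₁, h₂, h₃, h₄, hall⟩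
  apply ladderStep_word_four v₁ _ _ _ _ hall
  rw [ladderStep_ladderColoring h₁, ladderStep_ladderColoring h₂,
    ladderStep_ladderColoring h₃, ladderStep_ladderColoring h₄]

theorem not_hasBadC6_moebiusLadder : ¬ HasBadC6 moebiusLadder ladderColoring := by
  rintro ⟨v₁, v₂, v₃, v₄, v₅, v₆, -, h₁, h₂, h₃, h₄, h₅, h₆, e₁, e₂, e₃, hab, hbc, hac⟩
  apply ladderStep_word_six v₁ _ _ _ hab hbc hac
  rw [ladderStep_ladderColoring h₁, ladderStep_ladderColoring h₂,
    ladderStep_ladderColoring h₃, e₁, ladderStep_ladderColoring h₄, e₂,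
    ladderStep_ladderColoring h₅, e₃, ladderStep_ladderColoring h₆]

theorem not_hasRainbowC3_moebiusLadder : ¬ HasRainbowC3 moebiusLadder ladderColoring := by
  rintro ⟨v₁, v₂, v₃, -, h₁, h₂, h₃, hab, hbc, hac⟩
  apply ladderStep_word_three v₁ _ _ _ hab hbc hac
  rw [ladderStep_ladderColoring h₁, ladderStep_ladderColoring h₂, ladderStep_ladderColoring h₃]

theorem stmt11 :
    ∃ (G : SimpleGraph (Fin 8)) (c : Sym2 (Fin 8) → Fin 3),
      CubicGraph G ∧ ProperEdgeColoring G c ∧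
      ¬ HasRainbowC4 G c ∧ ¬ HasBadC6 G c ∧ ¬ HasRainbowC3 G c := by
  exact ⟨moebiusLadder, ladderColoring, moebiusLadder_cubicGraph, ladderColoring_proper,
    not_hasRainbowC4_moebiusLadder, not_hasBadC6_moebiusLadder, not_hasRainbowC3_moebiusLadder⟩
end

section
/- For every proper 3-edge-coloring of every 3-regular simple graph on 10 vertices, the colored graph contains at least one of the forbidden configurations: a 4-cycle using all three edge colors, a 6-cycle with opposite edges equal in color and all three colors appearing (pattern 1,2,3,1,2,3), or a triangle with three distinctly colored edges. That is, the cubic-graph construction lemma fails for k = 5. -/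
/-- The vertex reached from `v` by following the edges whose colors are listed in `w`. -/
def colorWalk {V : Type*} (σ : Fin 3 → V → V) (w : List (Fin 3)) (v : V) : V :=
  w.foldl (fun u i => σ i u) v

/-- The color words starting with `i` that may not occur around a closed walk: those of loops,
double edges, rainbow triangles, rainbow 4-cycles and bad 6-cycles. -/
def forbiddenWords (i : Fin 3) : List (List (Fin 3)) :=
  [(i + 1, i + 2), (i + 2, i + 1)].flatMap fun (j, k) =>
    [[i], [i, j], [i, j, k], [i, j, i, k], [i, j, k, j], [i, j, k, i, j, k]]

/-- A partial edge-colored graph on natural number labels: `(a, i, b)` records that the edge of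
color `i` at `a` leads to `b`. -/
abbrev PartialColoring := List (ℕ × Fin 3 × ℕ)

namespace PartialColoring

def lookup : PartialColoring → ℕ → Fin 3 → Option ℕ
  | [], _, _ => none
  | (a, i, b) :: E, x, l => if a = x ∧ i = l then some b else lookup E x l

def walk (E : PartialColoring) : List (Fin 3) → ℕ → Option ℕ
  | [], a => some a
  | i :: w, a => (E.lookup a i).bind (walk E w)

def addEdge (E : PartialColoring) (a : ℕ) (i : Fin 3) (b : ℕ) : PartialColoring :=
  (a, i, b) :: (b, i, a) :: E

def hasForbiddenWalk (E : PartialColoring) (a : ℕ) (i : Fin 3) : Bool :=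
  (forbiddenWords i).any fun w => E.walk w a == some a

/-- The edge of color `i` at `b < k` is known and does not lead to `a`. -/
def conflict (E : PartialColoring) (k a : ℕ) (i : Fin 3) (b : ℕ) : Bool :=
  match E.lookup b i with
  | none => false
  | some m => m != a && decide (m < k)

/-- The first label below `k` and color whose edge is still unknown. -/
def nextSlot (E : PartialColoring) (k : ℕ) : Option (ℕ × Fin 3) :=
  ((List.range k).product [0, 1, 2]).find? fun p => (E.lookup p.1 p.2).isNone

/-- Depth-first search refuting every extension of `E`, a partial graph on the labels below `k`,
to a properly 3-edge-colored cubic graph on `N` vertices without forbidden walks. -/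
def refute (N : ℕ) : ℕ → ℕ → PartialColoring → Bool
  | 0, _, _ => false
  | n + 1, k, E =>
    match E.nextSlot k with
    | none => decide (k < N) && refute N n (k + 1) E
    | some (a, i) =>
      decide (a < k) &&
      ((List.range k).all fun b =>
        E.conflict k a i b || (E.addEdge a i b).hasForbiddenWalk a i ||
          refute N n k (E.addEdge a i b)) &&
      (decide (N ≤ k) || (E.addEdge a i k).hasForbiddenWalk a i ||
        refute N n (k + 1) (E.addEdge a i k))

/-- The labelling `f` realizes `E` in the graph with neighbor maps `σ`. -/
def Realizes {V : Type*} (σ : Fin 3 → V → V) (f : ℕ → V) (E : PartialColoring) : Prop :=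
  ∀ a i b, (a, i, b) ∈ E → σ i (f a) = f b

variable {V : Type*} {σ : Fin 3 → V → V} {f : ℕ → V} {E : PartialColoring}

theorem mem_of_lookup_eq_some {a b : ℕ} {i : Fin 3} (h : E.lookup a i = some b) :
    (a, i, b) ∈ E := by
  induction E with
  | nil => simp [lookup] at h
  | cons e E ih =>
    obtain ⟨x, l, y⟩ := e
    rw [lookup] at h
    split_ifs at h with hx
    · obtain ⟨rfl, rfl⟩ := hx
      simp_all
    · exact List.mem_cons_of_mem _ (ih h)

theorem Realizes.colorWalk_eq (hE : Realizes σ f E) {w : List (Fin 3)} {a b : ℕ}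
    (h : E.walk w a = some b) : colorWalk σ w (f a) = f b := by
  induction w generalizing a with
  | nil => simp_all [walk, colorWalk]
  | cons i w ih =>
    obtain ⟨m, hm, hw⟩ := Option.bind_eq_some_iff.mp h
    have hσ := hE _ _ _ (mem_of_lookup_eq_some hm)
    simpa [colorWalk, hσ] using ih hw

theorem Realizes.addEdge (hE : Realizes σ f E) (hσ : ∀ i v, σ i (σ i v) = v) {a b : ℕ}
    {i : Fin 3} (h : σ i (f a) = f b) : Realizes σ f (E.addEdge a i b) := by
  intro x l y hxy
  simp only [PartialColoring.addEdge, List.mem_cons, Prod.mk.injEq] at hxy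
  rcases hxy with ⟨rfl, rfl, rfl⟩ | ⟨rfl, rfl, rfl⟩ | hxy
  · exact h
  · rw [← h, hσ]
  · exact hE _ _ _ hxy

theorem Realizes.hasForbiddenWalk_eq_false (hE : Realizes σ f E)
    (hw : ∀ i, ∀ w ∈ forbiddenWords i, ∀ v, colorWalk σ w v ≠ v) (a : ℕ) (i : Fin 3) :
    E.hasForbiddenWalk a i = false := by
  simp only [hasForbiddenWalk, List.any_eq_false, beq_iff_eq]
  exact fun w hwi h => hw i w hwi _ (hE.colorWalk_eq h)

theorem Realizes.conflict_eq_false (hE : Realizes σ f E) (hσ : ∀ i v, σ i (σ i v) = v) {k : ℕ}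
    (hf : Set.InjOn f (Set.Iio k)) {a b : ℕ} (ha : a < k) {i : Fin 3} (h : σ i (f a) = f b) :
    E.conflict k a i b = false := by
  unfold conflict
  split
  · rfl
  · next m hm =>
    have hfm : f m = f a := by rw [← hE _ _ _ (mem_of_lookup_eq_some hm), ← h, hσ]
    by_cases hk : m < k
    · simp [hf hk ha hfm]
    · simp [hk]

theorem Realizes.congr {g : ℕ → V} {k : ℕ} (hE : Realizes σ f E)
    (hlt : ∀ a i b, (a, i, b) ∈ E → a < k ∧ b < k) (hfg : ∀ a < k, g a = f a) :
    Realizes σ g E := by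
  intro a i b h
  rw [hfg a (hlt a i b h).1, hfg b (hlt a i b h).2]
  exact hE a i b h

theorem lt_of_mem_addEdge {k l : ℕ} (hkl : k ≤ l)
    (hlt : ∀ a i b, (a, i, b) ∈ E → a < k ∧ b < k) {x y : ℕ} (hx : x < l) (hy : y < l)
    {j : Fin 3} : ∀ a i b, (a, i, b) ∈ E.addEdge x j y → a < l ∧ b < l := by
  intro a i b h
  simp only [addEdge, List.mem_cons, Prod.mk.injEq] at h
  rcases h with ⟨rfl, rfl, rfl⟩ | ⟨rfl, rfl, rfl⟩ | h
  · exact ⟨hx, hy⟩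
  · exact ⟨hy, hx⟩
  · exact ⟨(hlt a i b h).1.trans_le hkl, (hlt a i b h).2.trans_le hkl⟩

theorem injOn_update {k : ℕ} (hf : Set.InjOn f (Set.Iio k)) {v : V} (hv : ∀ b < k, f b ≠ v) :
    Set.InjOn (Function.update f k v) (Set.Iio (k + 1)) := by
  intro x hx y hy
  simp only [Set.mem_Iio, Order.lt_add_one_iff] at hx hy
  have := @hf x
  grind [Function.update_apply]

theorem card_le_of_injOn [Fintype V] {k : ℕ} (hf : Set.InjOn f (Set.Iio k)) :
    k ≤ Fintype.card V := by
  simpa using Finset.card_le_card_of_injOn (s := Finset.range k) (t := Finset.univ) f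
    (by simp) (by simpa using hf)

theorem exists_forall_lt_ne [Fintype V] {k : ℕ} (hk : k < Fintype.card V) (f : ℕ → V) :
    ∃ v, ∀ b < k, f b ≠ v := by
  classical
  obtain ⟨v, -, hv⟩ := Finset.exists_mem_notMem_of_card_lt_card
    (s := (Finset.range k).image f) (t := Finset.univ)
    (Finset.card_image_le.trans_lt (by simpa using hk))
  exact ⟨v, by simpa using hv⟩

theorem Realizes.refute_eq_false [Fintype V] (hσ : ∀ i v, σ i (σ i v) = v)
    (hw : ∀ i, ∀ w ∈ forbiddenWords i, ∀ v, colorWalk σ w v ≠ v) (n : ℕ) {k : ℕ}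
    (hE : Realizes σ f E) (hf : Set.InjOn f (Set.Iio k))
    (hlt : ∀ a i b, (a, i, b) ∈ E → a < k ∧ b < k) :
    refute (Fintype.card V) n k E = false := by
  induction n generalizing k f E with
  | zero => rfl
  | succ n ih =>
    have hupdate (v : V) : ∀ x < k, Function.update f k v x = f x :=
      fun x hx => Function.update_of_ne hx.ne _ _
    rw [refute, Bool.eq_false_iff]
    intro h
    split at h
    · simp only [Bool.and_eq_true, decide_eq_true_eq] at h
      obtain ⟨hk, h⟩ := h
      obtain ⟨v, hv⟩ := exists_forall_lt_ne hk f
      have := ih (hE.congr hlt (hupdate v)) (injOn_update hf hv)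
        fun a i b hab => (hlt a i b hab).imp Nat.lt_succ_of_lt Nat.lt_succ_of_lt
      simp [this] at h
    · next a i _ =>
      simp only [Bool.and_eq_true, decide_eq_true_eq, List.all_eq_true, List.mem_range,
        Bool.or_eq_true, or_assoc] at h
      obtain ⟨⟨ha, hold⟩, hnew⟩ := h
      by_cases hb : ∃ b < k, f b = σ i (f a)
      · obtain ⟨b, hbk, hb⟩ := hb
        have hE' := hE.addEdge hσ hb.symm
        simpa [hE.conflict_eq_false hσ hf ha hb.symm, hE'.hasForbiddenWalk_eq_false hw,
          ih hE' hf (lt_of_mem_addEdge le_rfl hlt ha hbk)] using hold b hbk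
      · push Not at hb
        have hinj := injOn_update hf hb
        have hE' : Realizes σ (Function.update f k (σ i (f a))) (E.addEdge a i k) :=
          (hE.congr hlt (hupdate _)).addEdge hσ (by rw [hupdate _ a ha, Function.update_self])
        have hcard := card_le_of_injOn hinj
        have hlt' := lt_of_mem_addEdge k.le_succ hlt (j := i) (ha.trans k.lt_succ_self)
          k.lt_succ_self
        simp [hE'.hasForbiddenWalk_eq_false hw, ih hE' hinj hlt'] at hnew
        omega

end PartialColoring

/-- The neighbor maps of a properly 3-edge-colored cubic graph on ten vertices close up along some
forbidden word. -/
theorem exists_forbidden_colorWalk {V : Type*} [Fintype V] (hV : Fintype.card V = 10)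
    (σ : Fin 3 → V → V) (hσ : ∀ i v, σ i (σ i v) = v) :
    ∃ i, ∃ w ∈ forbiddenWords i, ∃ v, colorWalk σ w v = v := by
  by_contra! hw
  have : Nonempty V := Fintype.card_pos_iff.mp (by omega)
  have hE : PartialColoring.Realizes σ (fun _ => Classical.arbitrary V) [] := by
    simp [PartialColoring.Realizes]
  have hfalse := hE.refute_eq_false hσ hw 26 (k := 0) (by simp) (by simp)
  have htrue : PartialColoring.refute 10 26 0 [] = true := by decide +kernel
  simp [hV, htrue] at hfalse

theorem CubicGraph.existsUnique_adj_color {V : Type*} {G : SimpleGraph V} {c : Sym2 V → Fin 3}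
    (hG : CubicGraph G) (hc : ProperEdgeColoring G c) (i : Fin 3) (v : V) :
    ∃! u, G.Adj v u ∧ c s(v, u) = i := by
  have hinj : Set.InjOn (fun u => c s(v, u)) (G.neighborSet v) := by
    intro u hu u' hu' h
    by_contra hne
    exact hc s(v, u) hu s(v, u') hu' (mt Sym2.congr_right.mp hne) ⟨v, by simp, by simp⟩ h
  have himage : (fun u => c s(v, u)) '' G.neighborSet v = Set.univ := by
    refine Set.eq_of_subset_of_ncard_le (Set.subset_univ _) ?_
    rw [hinj.ncard_image, hG v]
    simp
  obtain ⟨u, hu, hui⟩ := himage.symm ▸ Set.mem_univ i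
  exact ⟨u, ⟨hu, hui⟩, fun u' hu' => hinj hu'.1 hu (hu'.2.trans hui.symm)⟩

theorem mem_forbiddenWords {i : Fin 3} {w : List (Fin 3)} (hw : w ∈ forbiddenWords i) :
    ∃ j k, i ≠ j ∧ j ≠ k ∧ i ≠ k ∧
      w ∈ [[i], [i, j], [i, j, k], [i, j, i, k], [i, j, k, j], [i, j, k, i, j, k]] := by
  obtain ⟨⟨j, k⟩, hjk, hw⟩ := List.mem_flatMap.mp hw
  have hdistinct : i ≠ j ∧ j ≠ k ∧ i ≠ k := by
    clear hw
    decide +revert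
  exact ⟨j, k, hdistinct.1, hdistinct.2.1, hdistinct.2.2, hw⟩

theorem stmt12 (G : SimpleGraph (Fin 10)) (c : Sym2 (Fin 10) → Fin 3)
    (hG : CubicGraph G) (hc : ProperEdgeColoring G c) :
    HasRainbowC4 G c ∨ HasBadC6 G c ∨ HasRainbowC3 G c := by
  choose σ hσ hσu using hG.existsUnique_adj_color hc
  dsimp only at hσ hσu
  have hadj : ∀ i v, G.Adj v (σ i v) := fun i v => (hσ i v).1
  have hcol : ∀ i v, c s(v, σ i v) = i := fun i v => (hσ i v).2
  have hinv : ∀ i v, σ i (σ i v) = v := fun i v =>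
    (hσu i _ v ⟨(hadj i v).symm, by rw [Sym2.eq_swap, hcol]⟩).symm
  have hne : ∀ i v, σ i v ≠ v := fun i v => (hadj i v).ne'
  have hne₂ : ∀ {i j}, i ≠ j → ∀ v, σ j (σ i v) ≠ v := fun {i j} hij v h =>
    hij (by rw [← hcol i (σ i v), hinv, ← hcol j (σ i v), h])
  have hthree : ∀ {i j k : Fin 3}, i ≠ j → j ≠ k → i ≠ k → ∀ l, l = i ∨ l = j ∨ l = k := by
    decide
  have hC3 : ∀ {i j k}, i ≠ j → j ≠ k → i ≠ k → ∀ v, σ k (σ j (σ i v)) = v →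
      HasRainbowC3 G c := by
    intro i j k hij hjk hik v hv
    have h₃ := hadj k (σ j (σ i v))
    have c₃ := hcol k (σ j (σ i v))
    rw [hv] at h₃ c₃
    refine ⟨v, σ i v, σ j (σ i v), ?_, hadj _ _, hadj _ _, h₃, ?_⟩
    · simp only [List.pairwise_cons, List.mem_cons]
      grind
    · simpa only [hcol, c₃] using ⟨hij, hjk, hik⟩
  have hC4 : ∀ {i j k}, i ≠ j → j ≠ k → i ≠ k → ∀ v, σ k (σ i (σ j (σ i v))) = v →
      HasRainbowC4 G c := by
    intro i j k hij hjk hik v hv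
    have h₄ := hadj k (σ i (σ j (σ i v)))
    have c₄ := hcol k (σ i (σ j (σ i v)))
    rw [hv] at h₄ c₄
    refine ⟨v, σ i v, σ j (σ i v), σ i (σ j (σ i v)), ?_, hadj _ _, hadj _ _, hadj _ _, h₄, ?_⟩
    · simp only [List.pairwise_cons, List.mem_cons]
      grind
    · simp only [hcol, c₄]
      intro l
      have := hthree hij hjk hik l
      tauto
  have hC6 : ∀ {i j k}, i ≠ j → j ≠ k → i ≠ k → ∀ v,
      σ k (σ j (σ i (σ k (σ j (σ i v))))) = v → σ k (σ j (σ i v)) ≠ v → HasBadC6 G c := by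
    intro i j k hij hjk hik v hv hv₃
    have h₆ := hadj k (σ j (σ i (σ k (σ j (σ i v)))))
    have c₆ := hcol k (σ j (σ i (σ k (σ j (σ i v)))))
    rw [hv] at h₆ c₆
    refine ⟨v, σ i v, σ j (σ i v), σ k (σ j (σ i v)), σ i (σ k (σ j (σ i v))),
      σ j (σ i (σ k (σ j (σ i v)))), ?_, hadj _ _, hadj _ _, hadj _ _, hadj _ _, hadj _ _, h₆, ?_⟩
    · simp only [List.pairwise_cons, List.mem_cons]
      grind
    · simp only [hcol, c₆]
      exact ⟨trivial, trivial, trivial, hij, hjk, hik⟩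
  obtain ⟨i, w, hw, v, hv⟩ := exists_forbidden_colorWalk (by simp) σ hinv
  obtain ⟨j, k, hij, hjk, hik, hw⟩ := mem_forbiddenWords hw
  simp only [List.mem_cons, List.not_mem_nil, or_false] at hw
  rcases hw with rfl | rfl | rfl | rfl | rfl | rfl <;>
    simp only [colorWalk, List.foldl_cons, List.foldl_nil] at hv
  · exact absurd hv (hne i v)
  · exact absurd hv (hne₂ hij v)
  · exact Or.inr (Or.inr (hC3 hij hjk hik v hv))
  · exact Or.inl (hC4 hij hjk hik v hv)
  · exact Or.inl (hC4 hjk hik.symm hij.symm (σ i v) (by rw [hv]))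
  · by_cases hv₃ : σ k (σ j (σ i v)) = v
    · exact Or.inr (Or.inr (hC3 hij hjk hik v hv₃))
    · exact Or.inr (Or.inl (hC6 hij hjk hik v hv hv₃))
end
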